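/- arXiv:2307.01518 — 3 statements merged into one kernel-verified Lean document; each statement's English description precedes it below -/
import Mathlib

section
/- (Lemma 1: decay rate of the total energy.) For every t ∈ (0,T), the energy is differentiable and dE(t)/dt = −∫₀^ℓ μ(x) u_t(x,t)² dx − k_a⁻ u_xt(0,t)² − k_a⁺ u_xt(ℓ,t)². -/
open Set intervalIntegral

noncomputable def pdx (u : ℝ → ℝ → ℝ) (x t : ℝ) : ℝ := deriv (fun y => u y t) x
noncomputable def pdt (u : ℝ → ℝ → ℝ) (x t : ℝ) : ℝ := deriv (fun s => u x s) t

noncomputable def beamEnergy (m r : ℝ → ℝ) (krm krp ℓ : ℝ) (u : ℝ → ℝ → ℝ) (t : ℝ) : ℝ :=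
  (1/2) * (∫ x in (0:ℝ)..ℓ, (m x * (pdt u x t)^2 + r x * (pdx (pdx u) x t)^2))
    + (1/2) * krm * (pdx u 0 t)^2 + (1/2) * krp * (pdx u ℓ t)^2

open Function Topology
open MeasureTheory (volume)

section PartialDerivatives

variable {u : ℝ → ℝ → ℝ}

theorem pdx_eq_fderiv (hu : Differentiable ℝ (uncurry u)) (x t : ℝ) :
    pdx u x t = fderiv ℝ (uncurry u) (x, t) (1, 0) := by
  have h := (hu (x, t)).hasFDerivAt.comp_hasDerivAt x
    ((hasDerivAt_id x).prodMk (hasDerivAt_const x t))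
  exact h.deriv

theorem pdt_eq_fderiv (hu : Differentiable ℝ (uncurry u)) (x t : ℝ) :
    pdt u x t = fderiv ℝ (uncurry u) (x, t) (0, 1) := by
  have h := (hu (x, t)).hasFDerivAt.comp_hasDerivAt t
    ((hasDerivAt_const t x).prodMk (hasDerivAt_id t))
  exact h.deriv

theorem hasDerivAt_pdx (hu : Differentiable ℝ (uncurry u)) (x t : ℝ) :
    HasDerivAt (fun y => u y t) (pdx u x t) x :=
  ((hu (x, t)).comp (f := fun y : ℝ => (y, t)) x (by fun_prop)).hasDerivAt

theorem hasDerivAt_pdt (hu : Differentiable ℝ (uncurry u)) (x t : ℝ) :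
    HasDerivAt (fun s => u x s) (pdt u x t) t :=
  ((hu (x, t)).comp (f := fun s : ℝ => (x, s)) t (by fun_prop)).hasDerivAt

theorem uncurry_pdx (hu : Differentiable ℝ (uncurry u)) :
    uncurry (pdx u) = fun p => fderiv ℝ (uncurry u) p (1, 0) :=
  funext fun p => pdx_eq_fderiv hu p.1 p.2

theorem uncurry_pdt (hu : Differentiable ℝ (uncurry u)) :
    uncurry (pdt u) = fun p => fderiv ℝ (uncurry u) p (0, 1) :=
  funext fun p => pdt_eq_fderiv hu p.1 p.2

theorem contDiff_pdx (hu : ContDiff ℝ (⊤ : ℕ∞) (uncurry u)) :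
    ContDiff ℝ (⊤ : ℕ∞) (uncurry (pdx u)) := by
  rw [uncurry_pdx (hu.differentiable (by simp))]
  exact (hu.fderiv_right (by simp)).clm_apply contDiff_const

theorem contDiff_pdt (hu : ContDiff ℝ (⊤ : ℕ∞) (uncurry u)) :
    ContDiff ℝ (⊤ : ℕ∞) (uncurry (pdt u)) := by
  rw [uncurry_pdt (hu.differentiable (by simp))]
  exact (hu.fderiv_right (by simp)).clm_apply contDiff_const

theorem pdt_pdx_comm (hu : ContDiff ℝ (⊤ : ℕ∞) (uncurry u)) :
    pdt (pdx u) = pdx (pdt u) := by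
  have hd : Differentiable ℝ (uncurry u) := hu.differentiable (by simp)
  have hf : Differentiable ℝ (fderiv ℝ (uncurry u)) :=
    (hu.fderiv_right (m := (⊤ : ℕ∞)) (by simp)).differentiable (by simp)
  have hsymm (p : ℝ × ℝ) : IsSymmSndFDerivAt ℝ (uncurry u) p :=
    hu.contDiffAt.isSymmSndFDerivAt (by simpa using WithTop.coe_le_coe.2 (le_top (a := (2 : ℕ∞))))
  funext x t
  rw [pdt_eq_fderiv ((contDiff_pdx hu).differentiable (by simp)),
    pdx_eq_fderiv ((contDiff_pdt hu).differentiable (by simp)), uncurry_pdx hd, uncurry_pdt hd,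
    fderiv_clm_apply (hf _) (by fun_prop), fderiv_clm_apply (hf _) (by fun_prop)]
  simpa using (hsymm (x, t)).eq (0, 1) (1, 0)

end PartialDerivatives

theorem hasDerivAt_integral_mul_sq {ℓ : ℝ} (hℓ : 0 ≤ ℓ) {a : ℝ → ℝ} {g : ℝ → ℝ → ℝ}
    (ha : ContinuousOn a (Icc 0 ℓ)) (hg : ContDiff ℝ (⊤ : ℕ∞) (uncurry g)) (t : ℝ) :
    HasDerivAt (fun s => ∫ x in (0:ℝ)..ℓ, a x * g x s ^ 2)
      (∫ x in (0:ℝ)..ℓ, a x * (2 * g x t * pdt g x t)) t := by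
  have hgc : Continuous fun p : ℝ × ℝ => g p.1 p.2 := hg.continuous
  have hgtc : Continuous fun p : ℝ × ℝ => pdt g p.1 p.2 := (contDiff_pdt hg).continuous
  have hF (s : ℝ) : ContinuousOn (fun x => a x * g x s ^ 2) (uIcc 0 ℓ) := by
    rw [uIcc_of_le hℓ]
    exact ha.mul ((hgc.comp (by fun_prop : Continuous fun x : ℝ => (x, s))).pow 2).continuousOn
  have hF' : ContinuousOn (fun p : ℝ × ℝ => a p.1 * (2 * g p.1 p.2 * pdt g p.1 p.2))
      (Icc 0 ℓ ×ˢ Icc (t - 1) (t + 1)) :=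
    (ha.comp continuousOn_fst fun p hp => hp.1).mul (by fun_prop)
  have hF't : ContinuousOn (fun x => a x * (2 * g x t * pdt g x t)) (uIcc 0 ℓ) := by
    rw [uIcc_of_le hℓ]
    exact hF'.comp (f := fun x : ℝ => (x, t)) (by fun_prop)
      fun x hx => ⟨hx, by simp⟩
  obtain ⟨C, hC⟩ := (isCompact_Icc.prod isCompact_Icc).exists_bound_of_continuousOn hF'
  refine (hasDerivAt_integral_of_dominated_loc_of_deriv_le
    (F := fun s x => a x * g x s ^ 2) (F' := fun s x => a x * (2 * g x s * pdt g x s))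
    (bound := fun _ => C) (s := Icc (t - 1) (t + 1)) (Icc_mem_nhds (by simp) (by simp))
    (.of_forall fun s => ?_) (hF t).intervalIntegrable ?_ (.of_forall fun x hx s hs => ?_)
    intervalIntegrable_const (.of_forall fun x _ s _ => ?_)).2
  · exact (hF s).intervalIntegrable.def'.aestronglyMeasurable
  · exact hF't.intervalIntegrable.def'.aestronglyMeasurable
  · rw [uIoc_of_le hℓ] at hx
    exact hC (x, s) ⟨Ioc_subset_Icc_self hx, hs⟩
  · simpa using ((hasDerivAt_pdt (hg.differentiable (by simp)) x s).fun_pow 2).const_mul (a x)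

/-- Twofold integration by parts for functions of `x` that depend on a parameter `t`. -/
theorem integral_mul_pdx_pdx {v q : ℝ → ℝ → ℝ} (hv : ContDiff ℝ (⊤ : ℕ∞) (uncurry v))
    (hq : ContDiff ℝ (⊤ : ℕ∞) (uncurry q)) (a b t : ℝ) :
    ∫ x in a..b, v x t * pdx (pdx q) x t =
      v b t * pdx q b t - v a t * pdx q a t - (pdx v b t * q b t - pdx v a t * q a t)
        + ∫ x in a..b, pdx (pdx v) x t * q x t := by
  have hd {w : ℝ → ℝ → ℝ} (hw : ContDiff ℝ (⊤ : ℕ∞) (uncurry w)) (x : ℝ) :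
      HasDerivAt (fun y => w y t) (pdx w x t) x := hasDerivAt_pdx (hw.differentiable (by simp)) x t
  have hi {w : ℝ → ℝ → ℝ} (hw : ContDiff ℝ (⊤ : ℕ∞) (uncurry w)) :
      IntervalIntegrable (fun y => w y t) volume a b :=
    (hw.continuous.comp (by fun_prop : Continuous fun x : ℝ => (x, t))).intervalIntegrable a b
  have hv₁ := contDiff_pdx hv
  have hq₁ := contDiff_pdx hq
  rw [integral_mul_deriv_eq_deriv_mul (fun x _ => hd hv x) (fun x _ => hd hq₁ x) (hi hv₁)
      (hi (contDiff_pdx hq₁)),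
    integral_mul_deriv_eq_deriv_mul (fun x _ => hd hv₁ x) (fun x _ => hd hq x)
      (hi (contDiff_pdx hv₁)) (hi hq₁)]
  ring

theorem energy_decay_rate
    (ℓ T m₀ m₁ μ₀ μ₁ r₀ r₁ krm kam krp kap : ℝ)
    (m μ r : ℝ → ℝ) (u : ℝ → ℝ → ℝ)
    (hℓ : 0 < ℓ) (hT : 0 < T)
    (hm₀ : 0 < m₀) (hμ₀ : 0 ≤ μ₀) (hr₀ : 0 < r₀)
    (hmc : ContinuousOn m (Icc 0 ℓ)) (hμc : ContinuousOn μ (Icc 0 ℓ))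
    (hrc : ContinuousOn r (Icc 0 ℓ))
    (hmb : ∀ x ∈ Icc 0 ℓ, m₀ ≤ m x ∧ m x ≤ m₁)
    (hμb : ∀ x ∈ Icc 0 ℓ, μ₀ ≤ μ x ∧ μ x ≤ μ₁)
    (hrb : ∀ x ∈ Icc 0 ℓ, r₀ ≤ r x ∧ r x ≤ r₁)
    (hkrm : 0 ≤ krm) (hkam : 0 ≤ kam) (hkrp : 0 ≤ krp) (hkap : 0 ≤ kap)
    (hu : ContDiff ℝ (⊤ : ℕ∞) (Function.uncurry u))
    (hq : ContDiff ℝ (⊤ : ℕ∞) (Function.uncurry (fun x t => r x * pdx (pdx u) x t)))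
    (hpde : ∀ x ∈ Ioo 0 ℓ, ∀ t ∈ Ioo 0 T,
      m x * pdt (pdt u) x t + μ x * pdt u x t
        + pdx (pdx (fun y s => r y * pdx (pdx u) y s)) x t = 0)
    (hbu0 : ∀ t ∈ Icc 0 T, u 0 t = 0)
    (hbuℓ : ∀ t ∈ Icc 0 T, u ℓ t = 0)
    (hbm0 : ∀ t ∈ Icc 0 T,
      -(r 0 * pdx (pdx u) 0 t) = -(krm * pdx u 0 t) - kam * pdt (pdx u) 0 t)
    (hbmℓ : ∀ t ∈ Icc 0 T,
      -(r ℓ * pdx (pdx u) ℓ t) = krp * pdx u ℓ t + kap * pdt (pdx u) ℓ t) :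
    ∀ t ∈ Ioo 0 T,
      HasDerivAt (beamEnergy m r krm krp ℓ u)
        (-(∫ x in (0:ℝ)..ℓ, μ x * (pdt u x t)^2)
          - kam * (pdt (pdx u) 0 t)^2 - kap * (pdt (pdx u) ℓ t)^2) t := by
  intro t ht
  have hut := contDiff_pdt hu
  have hux := contDiff_pdx hu
  have huxx := contDiff_pdx hux
  set q : ℝ → ℝ → ℝ := fun x t => r x * pdx (pdx u) x t with hqdef
  have hslice {w : ℝ → ℝ → ℝ} (hw : ContDiff ℝ (⊤ : ℕ∞) (uncurry w)) (s : ℝ) :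
      Continuous fun x => w x s := hw.continuous.comp (by fun_prop : Continuous fun x : ℝ => (x, s))
  have hint {a : ℝ → ℝ} {w : ℝ → ℝ → ℝ} (ha : ContinuousOn a (Icc 0 ℓ))
      (hw : ContDiff ℝ (⊤ : ℕ∞) (uncurry w)) (s : ℝ) :
      IntervalIntegrable (fun x => a x * w x s ^ 2) volume 0 ℓ := by
    refine ContinuousOn.intervalIntegrable ?_
    rw [uIcc_of_le hℓ.le]
    exact ha.mul ((hslice hw s).pow 2).continuousOn
  have hE : beamEnergy m r krm krp ℓ u = fun s =>
      (1/2) * ((∫ x in (0:ℝ)..ℓ, m x * pdt u x s ^ 2)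
        + ∫ x in (0:ℝ)..ℓ, r x * pdx (pdx u) x s ^ 2)
      + (1/2) * krm * pdx u 0 s ^ 2 + (1/2) * krp * pdx u ℓ s ^ 2 := by
    funext s
    rw [beamEnergy, integral_add (hint hmc hut s) (hint hrc huxx s)]
  have hsq (x : ℝ) : HasDerivAt (fun s => pdx u x s ^ 2) (2 * pdx u x t * pdt (pdx u) x t) t := by
    simpa using (hasDerivAt_pdt (hux.differentiable (by simp)) x t).fun_pow 2
  have hvanish {x : ℝ} (h : ∀ s ∈ Icc 0 T, u x s = 0) : pdt u x t = 0 := by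
    have : (fun s => u x s) =ᶠ[𝓝 t] fun _ => 0 :=
      Filter.eventually_of_mem (Icc_mem_nhds ht.1 ht.2) h
    rw [pdt, this.deriv_eq, deriv_const]
  have hkinetic : ∫ x in (0:ℝ)..ℓ, m x * (2 * pdt u x t * pdt (pdt u) x t) =
      -2 * (∫ x in (0:ℝ)..ℓ, μ x * pdt u x t ^ 2)
        - 2 * ∫ x in (0:ℝ)..ℓ, pdt u x t * pdx (pdx q) x t := by
    have hpower : IntervalIntegrable (fun x => pdt u x t * pdx (pdx q) x t) volume 0 ℓ :=
      ((hslice hut t).mul (hslice (contDiff_pdx (contDiff_pdx hq)) t)).intervalIntegrable 0 ℓ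
    rw [← integral_const_mul, ← integral_const_mul, ← integral_sub
      ((hint hμc hut t).const_mul _) (hpower.const_mul _)]
    refine integral_congr_Ioo_of_le hℓ.le fun x hx => ?_
    linear_combination 2 * pdt u x t * hpde x hx t ht
  have helastic : ∫ x in (0:ℝ)..ℓ, r x * (2 * pdx (pdx u) x t * pdt (pdx (pdx u)) x t) =
      2 * ∫ x in (0:ℝ)..ℓ, pdx (pdx (pdt u)) x t * q x t := by
    rw [← integral_const_mul, pdt_pdx_comm hux, pdt_pdx_comm hu]
    refine integral_congr fun x _ => ?_
    simp only [hqdef]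
    ring
  have hparts := integral_mul_pdx_pdx hut hq 0 ℓ t
  rw [hvanish hbu0, hvanish hbuℓ, ← pdt_pdx_comm hu] at hparts
  have hb0 := hbm0 t (Ioo_subset_Icc_self ht)
  have hbl := hbmℓ t (Ioo_subset_Icc_self ht)
  rw [hE]
  refine (((((hasDerivAt_integral_mul_sq hℓ.le hmc hut t).add
    (hasDerivAt_integral_mul_sq hℓ.le hrc huxx t)).const_mul (1/2)).add
    ((hsq 0).const_mul ((1/2) * krm))).add ((hsq ℓ).const_mul ((1/2) * krp))).congr_deriv ?_
  rw [hkinetic, helastic, hparts, pdt_pdx_comm hu]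
  rw [pdt_pdx_comm hu] at hb0 hbl
  simp only [hqdef]
  linear_combination -pdx (pdt u) ℓ t * hbl + pdx (pdt u) 0 t * hb0
end

section
/- (Estimate (16): weighted Poincaré-type bound.) If v : [0,ℓ] → ℝ is twice continuously differentiable with v(0) = v(ℓ) = 0, then ∫₀^ℓ μ(x) v(x)² dx ≤ (ℓ⁴ μ₁/(4 r₀)) ∫₀^ℓ r(x) v''(x)² dx. -/
open Set intervalIntegral

/-- Pointwise Cauchy–Schwarz bound for a `C¹` function vanishing at the left end point. -/
theorem sq_le_mul_integral_deriv_sq {v : ℝ → ℝ} (hv : ContDiff ℝ 1 v) (hv0 : v 0 = 0)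
    {x : ℝ} (hx : 0 ≤ x) : (v x)^2 ≤ x * ∫ t in (0:ℝ)..x, (deriv v t)^2 := by
  rcases hx.eq_or_lt with rfl | hx
  · simp [hv0]
  have hc : Continuous (deriv v) := hv.continuous_deriv le_rfl
  have ftc : ∫ t in (0:ℝ)..x, deriv v t = v x := by
    rw [integral_deriv_eq_sub (fun t _ => hv.differentiable one_ne_zero t)
      (hc.intervalIntegrable _ _), hv0, sub_zero]
  have nonneg : 0 ≤ ∫ t in (0:ℝ)..x, (x * deriv v t - v x)^2 :=
    integral_nonneg hx.le fun t _ => sq_nonneg _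
  have expand : ∫ t in (0:ℝ)..x, (x * deriv v t - v x)^2
      = x^2 * (∫ t in (0:ℝ)..x, (deriv v t)^2) - 2 * x * v x * v x + x * (v x)^2 := by
    have h : ∀ t, (x * deriv v t - v x)^2
        = x^2 * (deriv v t)^2 - 2 * x * v x * deriv v t + (v x)^2 := fun t => by ring
    simp only [h]
    rw [integral_add, integral_sub, integral_const_mul, integral_const_mul, ftc, integral_const,
      sub_zero, smul_eq_mul]
    all_goals exact Continuous.intervalIntegrable (by fun_prop) _ _
  have : 0 ≤ x * (x * (∫ t in (0:ℝ)..x, (deriv v t)^2) - (v x)^2) := by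
    rw [expand] at nonneg
    linarith
  linarith [nonneg_of_mul_nonneg_right this hx]

/-- Poincaré inequality for a `C¹` function vanishing at the left end point. -/
theorem integral_sq_le_integral_deriv_sq {v : ℝ → ℝ} (hv : ContDiff ℝ 1 v) (hv0 : v 0 = 0)
    {ℓ : ℝ} (hℓ : 0 ≤ ℓ) :
    ∫ x in (0:ℝ)..ℓ, (v x)^2 ≤ ℓ^2 / 2 * ∫ x in (0:ℝ)..ℓ, (deriv v x)^2 := by
  have hc : Continuous (deriv v) := hv.continuous_deriv le_rfl
  have hcv : Continuous v := hv.continuous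
  calc ∫ x in (0:ℝ)..ℓ, (v x)^2
      ≤ ∫ x in (0:ℝ)..ℓ, x * ∫ t in (0:ℝ)..ℓ, (deriv v t)^2 := by
        refine integral_mono_on hℓ ((hcv.pow 2).intervalIntegrable _ _)
          (Continuous.intervalIntegrable (by fun_prop) _ _) fun x hx => ?_
        refine (sq_le_mul_integral_deriv_sq hv hv0 hx.1).trans
          (mul_le_mul_of_nonneg_left ?_ hx.1)
        exact integral_mono_interval le_rfl hx.1 hx.2 (.of_forall fun t => sq_nonneg _)
          ((hc.pow 2).intervalIntegrable _ _)
    _ = ℓ^2 / 2 * ∫ x in (0:ℝ)..ℓ, (deriv v x)^2 := by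
        rw [integral_mul_const, integral_id]
        ring

/-- Second-order Poincaré inequality for a `C²` function vanishing at both end points. -/
theorem integral_sq_le_integral_deriv_deriv_sq {v : ℝ → ℝ} (hv : ContDiff ℝ 2 v) {ℓ : ℝ}
    (hℓ : 0 < ℓ) (hv0 : v 0 = 0) (hvℓ : v ℓ = 0) :
    ∫ x in (0:ℝ)..ℓ, (v x)^2 ≤ ℓ^4 / 4 * ∫ x in (0:ℝ)..ℓ, (deriv (deriv v) x)^2 := by
  have hv1 : ContDiff ℝ 1 v := hv.of_le one_le_two
  have hd : ContDiff ℝ 1 (deriv v) := ((contDiff_succ_iff_deriv (n := 1)).1 hv).2.2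
  have hcv : Continuous v := hv.continuous
  have hc : Continuous (deriv v) := hd.continuous
  have hcc : Continuous (deriv (deriv v)) := hd.continuous_deriv le_rfl
  have poincare := integral_sq_le_integral_deriv_sq hv1 hv0 hℓ.le
  have parts : ∫ x in (0:ℝ)..ℓ, (deriv v x)^2 = ∫ x in (0:ℝ)..ℓ, -(v x * deriv (deriv v) x) := by
    have := integral_mul_deriv_eq_deriv_mul (a := 0) (b := ℓ)
      (fun x _ => (hv1.differentiable one_ne_zero x).hasDerivAt)
      (fun x _ => (hd.differentiable one_ne_zero x).hasDerivAt)
      (hc.intervalIntegrable _ _) (hcc.intervalIntegrable _ _)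
    rw [integral_neg, this, hv0, hvℓ]
    simp [sq]
  have young : ∫ x in (0:ℝ)..ℓ, -(v x * deriv (deriv v) x)
      ≤ 1 / ℓ^2 * (∫ x in (0:ℝ)..ℓ, (v x)^2)
        + ℓ^2 / 4 * ∫ x in (0:ℝ)..ℓ, (deriv (deriv v) x)^2 := by
    rw [← integral_const_mul, ← integral_const_mul, ← integral_add]
    · refine integral_mono_on hℓ.le ?_ ?_ fun x _ => ?_
      · exact Continuous.intervalIntegrable (by fun_prop) _ _
      · exact Continuous.intervalIntegrable (by fun_prop) _ _
      · have h : 1 / ℓ^2 * (v x)^2 + ℓ^2 / 4 * (deriv (deriv v) x)^2 + v x * deriv (deriv v) x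
            = (v x / ℓ + ℓ / 2 * deriv (deriv v) x)^2 := by
          field_simp
          ring
        linarith [sq_nonneg (v x / ℓ + ℓ / 2 * deriv (deriv v) x)]
    all_goals exact Continuous.intervalIntegrable (by fun_prop) _ _
  have scaled : 1 / ℓ^2 * (∫ x in (0:ℝ)..ℓ, (v x)^2)
      ≤ 1 / 2 * ∫ x in (0:ℝ)..ℓ, (deriv v x)^2 := by
    calc _ ≤ 1 / ℓ^2 * (ℓ^2 / 2 * ∫ x in (0:ℝ)..ℓ, (deriv v x)^2) := by gcongr
      _ = _ := by field_simp
  have deriv_bound : ∫ x in (0:ℝ)..ℓ, (deriv v x)^2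
      ≤ ℓ^2 / 2 * ∫ x in (0:ℝ)..ℓ, (deriv (deriv v) x)^2 := by linarith
  calc _ ≤ ℓ^2 / 2 * ∫ x in (0:ℝ)..ℓ, (deriv v x)^2 := poincare
    _ ≤ ℓ^2 / 2 * (ℓ^2 / 2 * ∫ x in (0:ℝ)..ℓ, (deriv (deriv v) x)^2) := by gcongr
    _ = _ := by ring

theorem weighted_poincare_bound
    (ℓ μ₁ r₀ r₁ : ℝ) (μ r : ℝ → ℝ) (v : ℝ → ℝ)
    (hℓ : 0 < ℓ) (hr₀ : 0 < r₀)
    (hμc : ContinuousOn μ (Icc 0 ℓ)) (hrc : ContinuousOn r (Icc 0 ℓ))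
    (hμb : ∀ x ∈ Icc 0 ℓ, 0 ≤ μ x ∧ μ x ≤ μ₁)
    (hrb : ∀ x ∈ Icc 0 ℓ, r₀ ≤ r x ∧ r x ≤ r₁)
    (hv : ContDiff ℝ 2 v) (hv0 : v 0 = 0) (hvℓ : v ℓ = 0) :
    (∫ x in (0:ℝ)..ℓ, μ x * (v x)^2)
      ≤ ℓ^4 * μ₁ / (4 * r₀) * ∫ x in (0:ℝ)..ℓ, r x * (deriv (deriv v) x)^2 := by
  have hcv : Continuous v := hv.continuous
  have hd : ContDiff ℝ 1 (deriv v) := ((contDiff_succ_iff_deriv (n := 1)).1 hv).2.2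
  have hcc : Continuous (deriv (deriv v)) := hd.continuous_deriv le_rfl
  have hμ₁ : 0 ≤ μ₁ := (hμb 0 ⟨le_rfl, hℓ.le⟩).1.trans (hμb 0 ⟨le_rfl, hℓ.le⟩).2
  have upper : (∫ x in (0:ℝ)..ℓ, μ x * (v x)^2) ≤ μ₁ * ∫ x in (0:ℝ)..ℓ, (v x)^2 := by
    rw [← integral_const_mul]
    refine integral_mono_on hℓ.le ?_ ?_ fun x hx =>
      mul_le_mul_of_nonneg_right (hμb x hx).2 (sq_nonneg _)
    · exact (hμc.mul (hcv.pow 2).continuousOn).intervalIntegrable_of_Icc hℓ.le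
    · exact Continuous.intervalIntegrable (by fun_prop) _ _
  have lower : r₀ * (∫ x in (0:ℝ)..ℓ, (deriv (deriv v) x)^2)
      ≤ ∫ x in (0:ℝ)..ℓ, r x * (deriv (deriv v) x)^2 := by
    rw [← integral_const_mul]
    refine integral_mono_on hℓ.le ?_ ?_ fun x hx =>
      mul_le_mul_of_nonneg_right (hrb x hx).1 (sq_nonneg _)
    · exact Continuous.intervalIntegrable (by fun_prop) _ _
    · exact (hrc.mul (hcc.pow 2).continuousOn).intervalIntegrable_of_Icc hℓ.le
  calc _ ≤ μ₁ * ∫ x in (0:ℝ)..ℓ, (v x)^2 := upper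
    _ ≤ μ₁ * (ℓ^4 / 4 * ∫ x in (0:ℝ)..ℓ, (deriv (deriv v) x)^2) := by
        gcongr
        exact integral_sq_le_integral_deriv_deriv_sq hv hℓ hv0 hvℓ
    _ = ℓ^4 * μ₁ / (4 * r₀) * (r₀ * ∫ x in (0:ℝ)..ℓ, (deriv (deriv v) x)^2) := by
        field_simp
    _ ≤ _ := by gcongr
end

section
/- (Lyapunov differential inequality.) Let λ > 0 satisfy λ ≤ μ₀/(2 m₁) and define the Lyapunov function L(t) = E(t) + λ J(t). Then for every t ∈ (0,T), dL(t)/dt + 2λ E(t) ≤ 0. -/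
open Set intervalIntegral

noncomputable def beamJ (m μ : ℝ → ℝ) (kam kap ℓ : ℝ) (u : ℝ → ℝ → ℝ) (t : ℝ) : ℝ :=
  (∫ x in (0:ℝ)..ℓ, m x * u x t * pdt u x t)
    + (1/2) * (∫ x in (0:ℝ)..ℓ, μ x * (u x t)^2)
    + (1/2) * kam * (pdx u 0 t)^2 + (1/2) * kap * (pdx u ℓ t)^2

lemma hasDerivAt_pdx_s14 {f : ℝ → ℝ → ℝ} (hf : ContDiff ℝ (⊤ : ℕ∞) (Function.uncurry f)) (x t : ℝ) :
    HasDerivAt (fun y => f y t) (pdx f x t) x := by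
  have h : DifferentiableAt ℝ (fun y => Function.uncurry f (y, t)) x :=
    DifferentiableAt.comp (f := fun y => (y, t)) x (hf.differentiable (by simp) (x, t))
      (differentiableAt_id.prodMk (differentiableAt_const t))
  exact h.hasDerivAt

lemma hasDerivAt_pdt_s14 {f : ℝ → ℝ → ℝ} (hf : ContDiff ℝ (⊤ : ℕ∞) (Function.uncurry f)) (x t : ℝ) :
    HasDerivAt (fun s => f x s) (pdt f x t) t := by
  have h : DifferentiableAt ℝ (fun s => Function.uncurry f (x, s)) t :=
    DifferentiableAt.comp (f := fun s => (x, s)) t (hf.differentiable (by simp) (x, t))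
      ((differentiableAt_const x).prodMk differentiableAt_id)
  exact h.hasDerivAt

lemma pdx_eq_fderiv_s14 {f : ℝ → ℝ → ℝ} (hf : ContDiff ℝ (⊤ : ℕ∞) (Function.uncurry f)) (x t : ℝ) :
    pdx f x t = fderiv ℝ (Function.uncurry f) (x, t) (1, 0) :=
  (hasDerivAt_pdx_s14 hf x t).unique <|
    HasFDerivAt.comp_hasDerivAt (f := fun y => (y, t)) x
      (hf.differentiable (by simp) (x, t)).hasFDerivAt
      ((hasDerivAt_id x).prodMk (hasDerivAt_const x t))

lemma pdt_eq_fderiv_s14 {f : ℝ → ℝ → ℝ} (hf : ContDiff ℝ (⊤ : ℕ∞) (Function.uncurry f)) (x t : ℝ) :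
    pdt f x t = fderiv ℝ (Function.uncurry f) (x, t) (0, 1) :=
  (hasDerivAt_pdt_s14 hf x t).unique <|
    HasFDerivAt.comp_hasDerivAt (f := fun s => (x, s)) t
      (hf.differentiable (by simp) (x, t)).hasFDerivAt
      ((hasDerivAt_const t x).prodMk (hasDerivAt_id t))

lemma contDiff_pdx_s14 {f : ℝ → ℝ → ℝ} (hf : ContDiff ℝ (⊤ : ℕ∞) (Function.uncurry f)) :
    ContDiff ℝ (⊤ : ℕ∞) (Function.uncurry (pdx f)) := by
  have h : Function.uncurry (pdx f) = fun p => fderiv ℝ (Function.uncurry f) p (1, 0) :=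
    funext fun p => pdx_eq_fderiv_s14 hf p.1 p.2
  rw [h]
  exact (hf.fderiv_right (by norm_cast)).clm_apply contDiff_const

lemma contDiff_pdt_s14 {f : ℝ → ℝ → ℝ} (hf : ContDiff ℝ (⊤ : ℕ∞) (Function.uncurry f)) :
    ContDiff ℝ (⊤ : ℕ∞) (Function.uncurry (pdt f)) := by
  have h : Function.uncurry (pdt f) = fun p => fderiv ℝ (Function.uncurry f) p (0, 1) :=
    funext fun p => pdt_eq_fderiv_s14 hf p.1 p.2
  rw [h]
  exact (hf.fderiv_right (by norm_cast)).clm_apply contDiff_const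

lemma fderiv_fderiv_apply {E : Type*} [NormedAddCommGroup E] [NormedSpace ℝ E] {g : E → ℝ}
    (hg : ContDiff ℝ (⊤ : ℕ∞) g) (p v w : E) :
    fderiv ℝ (fun q => fderiv ℝ g q v) p w = fderiv ℝ (fderiv ℝ g) p w v := by
  have h : DifferentiableAt ℝ (fderiv ℝ g) p :=
    (hg.fderiv_right (m := (⊤ : ℕ∞)) (by norm_cast)).differentiable (by simp) p
  rw [fderiv_clm_apply h (differentiableAt_const v)]
  simp

lemma pdt_pdx_comm_s14 {f : ℝ → ℝ → ℝ} (hf : ContDiff ℝ (⊤ : ℕ∞) (Function.uncurry f)) :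
    pdt (pdx f) = pdx (pdt f) := by
  funext x t
  have hx : Function.uncurry (pdx f) = fun p => fderiv ℝ (Function.uncurry f) p (1, 0) :=
    funext fun p => pdx_eq_fderiv_s14 hf p.1 p.2
  have ht : Function.uncurry (pdt f) = fun p => fderiv ℝ (Function.uncurry f) p (0, 1) :=
    funext fun p => pdt_eq_fderiv_s14 hf p.1 p.2
  rw [pdt_eq_fderiv_s14 (contDiff_pdx_s14 hf), pdx_eq_fderiv_s14 (contDiff_pdt_s14 hf), hx, ht,
    fderiv_fderiv_apply hf, fderiv_fderiv_apply hf]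
  exact hf.contDiffAt.isSymmSndFDerivAt (by
    rw [minSmoothness_of_isRCLikeNormedField]
    exact WithTop.coe_le_coe.2 (le_top : (2 : ℕ∞) ≤ ⊤)) _ _

lemma hasDerivAt_integral_of_continuousOn_deriv {a b : ℝ} (hab : a ≤ b) {F F' : ℝ → ℝ → ℝ}
    (hF : ∀ s, ContinuousOn (fun x => F x s) (Icc a b))
    (hF' : ContinuousOn (Function.uncurry F') (Icc a b ×ˢ univ))
    (hd : ∀ x ∈ Icc a b, ∀ s, HasDerivAt (fun s => F x s) (F' x s) s) (t : ℝ) :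
    HasDerivAt (fun s => ∫ x in a..b, F x s) (∫ x in a..b, F' x t) t := by
  have hsub : uIoc a b ⊆ Icc a b := by
    rw [uIoc_of_le hab]; exact Ioc_subset_Icc_self
  have hK : IsCompact (Icc a b ×ˢ Icc (t - 1) (t + 1)) := isCompact_Icc.prod isCompact_Icc
  obtain ⟨C, hC⟩ := hK.exists_bound_of_continuousOn (hF'.mono (by gcongr; exact subset_univ _))
  have hF't : ContinuousOn (fun x => F' x t) (Icc a b) :=
    hF'.comp (f := fun x => (x, t)) (by fun_prop) (fun x hx => ⟨hx, mem_univ _⟩)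
  refine (intervalIntegral.hasDerivAt_integral_of_dominated_loc_of_deriv_le
    (F := fun s x => F x s) (F' := fun s x => F' x s) (bound := fun _ => C)
    (s := Icc (t - 1) (t + 1)) (Icc_mem_nhds (by linarith) (by linarith))
    (Filter.Eventually.of_forall fun s => ?_) ?_ ?_ ?_ (by simp) ?_).2
  · exact ((hF s).mono hsub).aestronglyMeasurable measurableSet_uIoc
  · exact ((hF t).mono (by rw [uIcc_of_le hab])).intervalIntegrable
  · exact (hF't.mono hsub).aestronglyMeasurable measurableSet_uIoc
  · exact Filter.Eventually.of_forall fun x hx s hs => hC (x, s) ⟨hsub hx, hs⟩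
  · exact Filter.Eventually.of_forall fun x hx s _ => hd x (hsub hx) s

/-- The second Green identity for fourth-order operators in one space variable. -/
lemma integral_mul_pdx_pdx_sub {f q : ℝ → ℝ → ℝ}
    (hf : ContDiff ℝ (⊤ : ℕ∞) (Function.uncurry f))
    (hq : ContDiff ℝ (⊤ : ℕ∞) (Function.uncurry q)) (a b t : ℝ) :
    ∫ x in a..b, (f x t * pdx (pdx q) x t - pdx (pdx f) x t * q x t) =
      (f b t * pdx q b t - pdx f b t * q b t) - (f a t * pdx q a t - pdx f a t * q a t) := by
  have c0 := hf.continuous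
  have c1 := hq.continuous
  have c2 := (contDiff_pdx_s14 (contDiff_pdx_s14 hf)).continuous
  have c3 := (contDiff_pdx_s14 (contDiff_pdx_s14 hq)).continuous
  apply integral_eq_sub_of_hasDerivAt
    (f := fun x => f x t * pdx q x t - pdx f x t * q x t)
  · intro x _
    have h := ((hasDerivAt_pdx_s14 hf x t).mul (hasDerivAt_pdx_s14 (contDiff_pdx_s14 hq) x t)).sub
      ((hasDerivAt_pdx_s14 (contDiff_pdx_s14 hf) x t).mul (hasDerivAt_pdx_s14 hq x t))
    refine h.congr_deriv ?_
    ring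
  · apply Continuous.intervalIntegrable
    fun_prop

theorem lyapunov_differential_inequality
    (ℓ T m₀ m₁ μ₀ μ₁ r₀ r₁ krm kam krp kap : ℝ)
    (m μ r : ℝ → ℝ) (u : ℝ → ℝ → ℝ)
    (hℓ : 0 < ℓ) (hT : 0 < T)
    (hm₀ : 0 < m₀) (hμ₀ : 0 ≤ μ₀) (hr₀ : 0 < r₀)
    (hmc : ContinuousOn m (Icc 0 ℓ)) (hμc : ContinuousOn μ (Icc 0 ℓ))
    (hrc : ContinuousOn r (Icc 0 ℓ))
    (hmb : ∀ x ∈ Icc 0 ℓ, m₀ ≤ m x ∧ m x ≤ m₁)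
    (hμb : ∀ x ∈ Icc 0 ℓ, μ₀ ≤ μ x ∧ μ x ≤ μ₁)
    (hrb : ∀ x ∈ Icc 0 ℓ, r₀ ≤ r x ∧ r x ≤ r₁)
    (hkrm : 0 ≤ krm) (hkam : 0 ≤ kam) (hkrp : 0 ≤ krp) (hkap : 0 ≤ kap)
    (hu : ContDiff ℝ (⊤ : ℕ∞) (Function.uncurry u))
    (hq : ContDiff ℝ (⊤ : ℕ∞) (Function.uncurry (fun x t => r x * pdx (pdx u) x t)))
    (hpde : ∀ x ∈ Ioo 0 ℓ, ∀ t ∈ Ioo 0 T,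
      m x * pdt (pdt u) x t + μ x * pdt u x t
        + pdx (pdx (fun y s => r y * pdx (pdx u) y s)) x t = 0)
    (hbu0 : ∀ t ∈ Icc 0 T, u 0 t = 0)
    (hbuℓ : ∀ t ∈ Icc 0 T, u ℓ t = 0)
    (hbm0 : ∀ t ∈ Icc 0 T,
      -(r 0 * pdx (pdx u) 0 t) = -(krm * pdx u 0 t) - kam * pdt (pdx u) 0 t)
    (hbmℓ : ∀ t ∈ Icc 0 T,
      -(r ℓ * pdx (pdx u) ℓ t) = krp * pdx u ℓ t + kap * pdt (pdx u) ℓ t)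
    (lam : ℝ) (hlam₁ : 0 < lam) (hlam₂ : lam ≤ μ₀ / (2 * m₁)) :
    ∀ t ∈ Ioo 0 T,
      ∃ d, HasDerivAt (fun s => beamEnergy m r krm krp ℓ u s + lam * beamJ m μ kam kap ℓ u s) d t ∧
        d + 2 * lam * beamEnergy m r krm krp ℓ u t ≤ 0 := by
  intro t ht
  have htI : t ∈ Icc 0 T := Ioo_subset_Icc_self ht
  set q : ℝ → ℝ → ℝ := fun x t => r x * pdx (pdx u) x t with hqdef
  have su_x := contDiff_pdx_s14 hu
  have su_xx := contDiff_pdx_s14 su_x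
  have su_t := contDiff_pdt_s14 hu
  have su_tt := contDiff_pdt_s14 su_t
  have su_tx := contDiff_pdx_s14 su_t
  have su_txx := contDiff_pdx_s14 su_tx
  have sq_xx := contDiff_pdx_s14 (contDiff_pdx_s14 hq)
  have comm1 : pdt (pdx u) = pdx (pdt u) := pdt_pdx_comm_s14 hu
  have comm2 : pdt (pdx (pdx u)) = pdx (pdx (pdt u)) := by
    rw [pdt_pdx_comm_s14 su_x, comm1]
  have c_u := hu.continuous
  have c_xx := su_xx.continuous
  have c_t := su_t.continuous
  have c_tt := su_tt.continuous
  have c_txx := su_txx.continuous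
  have c_qxx := sq_xx.continuous
  have c_q := hq.continuous
  have dE := hasDerivAt_integral_of_continuousOn_deriv hℓ.le
    (F := fun x s => m x * (pdt u x s)^2 + r x * (pdx (pdx u) x s)^2)
    (F' := fun x s => 2 * (m x * pdt u x s * pdt (pdt u) x s
      + r x * pdx (pdx u) x s * pdx (pdx (pdt u)) x s))
    (fun s => by fun_prop) (by
      simp only [Function.uncurry_def]
      fun_prop (disch := exact fun _ h => (Set.mem_prod.1 h).1))
    (fun x _ s => by
      have h1 := ((hasDerivAt_pdt_s14 su_t x s).pow 2).const_mul (m x)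
      have h2 := ((hasDerivAt_pdt_s14 su_xx x s).pow 2).const_mul (r x)
      refine (h1.add h2).congr_deriv ?_
      rw [comm2]; push_cast; ring) t
  have dJ := hasDerivAt_integral_of_continuousOn_deriv hℓ.le
    (F := fun x s => m x * u x s * pdt u x s)
    (F' := fun x s => m x * (pdt u x s)^2 + m x * u x s * pdt (pdt u) x s)
    (fun s => by fun_prop) (by
      simp only [Function.uncurry_def]
      fun_prop (disch := exact fun _ h => (Set.mem_prod.1 h).1))
    (fun x _ s => by
      refine (((hasDerivAt_pdt_s14 hu x s).const_mul (m x)).mul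
        (hasDerivAt_pdt_s14 su_t x s)).congr_deriv ?_
      ring) t
  have dM := hasDerivAt_integral_of_continuousOn_deriv hℓ.le
    (F := fun x s => μ x * (u x s)^2) (F' := fun x s => 2 * (μ x * u x s * pdt u x s))
    (fun s => by fun_prop) (by
      simp only [Function.uncurry_def]
      fun_prop (disch := exact fun _ h => (Set.mem_prod.1 h).1))
    (fun x _ s => by
      refine (((hasDerivAt_pdt_s14 hu x s).pow 2).const_mul (μ x)).congr_deriv ?_
      push_cast; ring) t
  have dsq : ∀ x, HasDerivAt (fun s => (pdx u x s)^2) (2 * (pdx u x t * pdx (pdt u) x t)) t :=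
    fun x => by
      refine ((hasDerivAt_pdt_s14 su_x x t).pow 2).congr_deriv ?_
      rw [comm1]; push_cast; ring
  refine ⟨_, ((((dE.const_mul (1/2)).add ((dsq 0).const_mul (1/2 * krm))).add
    ((dsq ℓ).const_mul (1/2 * krp))).add
    ((((dJ.add (dM.const_mul (1/2))).add ((dsq 0).const_mul (1/2 * kam))).add
      ((dsq ℓ).const_mul (1/2 * kap))).const_mul lam)), ?_⟩
  have hut : ∀ x, (∀ s ∈ Icc 0 T, u x s = 0) → pdt u x t = 0 := fun x hx =>
    (Filter.EventuallyEq.deriv_eq (f := fun _ => (0 : ℝ)) (by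
      filter_upwards [Icc_mem_nhds ht.1 ht.2] with s hs using hx s hs)).trans (deriv_const _ _)
  have green_t := integral_mul_pdx_pdx_sub su_t hq 0 ℓ t
  have green_u := integral_mul_pdx_pdx_sub hu hq 0 ℓ t
  rw [hut 0 hbu0, hut ℓ hbuℓ] at green_t
  rw [hbu0 t htI, hbuℓ t htI] at green_u
  have b0 : q 0 t = krm * pdx u 0 t + kam * pdx (pdt u) 0 t := by
    have := hbm0 t htI
    rw [comm1] at this
    simp only [hqdef]; linarith
  have bℓ : q ℓ t = -(krp * pdx u ℓ t + kap * pdx (pdt u) ℓ t) := by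
    have := hbmℓ t htI
    rw [comm1] at this
    simp only [hqdef]; linarith
  rw [b0, bℓ] at green_t green_u
  have integrable : ∀ f : ℝ → ℝ, ContinuousOn f (Icc 0 ℓ) →
      IntervalIntegrable f MeasureTheory.volume 0 ℓ := fun f hf =>
    (hf.mono (by rw [uIcc_of_le hℓ.le])).intervalIntegrable
  have i1 := integrable (fun x => 2 * (m x * pdt u x t * pdt (pdt u) x t
      + r x * pdx (pdx u) x t * pdx (pdx (pdt u)) x t)) (by fun_prop)
  have i2 := integrable (fun x => m x * (pdt u x t)^2 + m x * u x t * pdt (pdt u) x t)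
    (by fun_prop)
  have i3 := integrable (fun x => 2 * (μ x * u x t * pdt u x t)) (by fun_prop)
  have i4 := integrable (fun x => m x * (pdt u x t)^2 + r x * (pdx (pdx u) x t)^2) (by fun_prop)
  have i5 := integrable
    (fun x => pdt u x t * pdx (pdx q) x t - pdx (pdx (pdt u)) x t * q x t) (by fun_prop)
  have i6 := integrable
    (fun x => u x t * pdx (pdx q) x t - pdx (pdx u) x t * q x t) (by fun_prop)
  have mono := integral_mono_on_of_le_Ioo hℓ.le
    ((((i1.const_mul (1/2)).add (i2.const_mul lam)).add (i3.const_mul (lam/2))).add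
      (i4.const_mul lam))
    ((i5.const_mul (-1)).sub (i6.const_mul lam)) (fun x hx => by
      have hxI := Ioo_subset_Icc_self hx
      have hp := hpde x hx t ht
      have hm1 : 0 < m₁ := hm₀.trans_le ((hmb x hxI).1.trans (hmb x hxI).2)
      have hl : lam * (2 * m₁) ≤ μ₀ := (le_div_iff₀ (by positivity)).1 hlam₂
      have hw : 2 * lam * m x - μ x ≤ 0 := by
        have h1 := mul_le_mul_of_nonneg_left (hmb x hxI).2 hlam₁.le
        linarith [(hμb x hxI).1]
      have hw2 := mul_nonpos_of_nonpos_of_nonneg hw (sq_nonneg (pdt u x t))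
      have hqx : q x t = r x * pdx (pdx u) x t := rfl
      have hqq : pdx (pdx q) x t = -(m x * pdt (pdt u) x t + μ x * pdt u x t) := by linarith
      rw [hqq, hqx]
      linarith)
  rw [integral_add (((i1.const_mul (1/2)).add (i2.const_mul lam)).add (i3.const_mul (lam/2)))
      (i4.const_mul lam),
    integral_add ((i1.const_mul (1/2)).add (i2.const_mul lam)) (i3.const_mul (lam/2)),
    integral_add (i1.const_mul (1/2)) (i2.const_mul lam),
    integral_sub (i5.const_mul (-1)) (i6.const_mul lam)] at mono
  unfold beamEnergy
  simp only [intervalIntegral.integral_const_mul] at mono ⊢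
  rw [green_t, green_u] at mono
  have k1 : 0 ≤ kam * (pdx (pdt u) 0 t)^2 := by positivity
  have k2 : 0 ≤ kap * (pdx (pdt u) ℓ t)^2 := by positivity
  linarith
end
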